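/- Let p, k be positive integers with k dividing p and p > 1, set m = p/k, and let u, v ∈ ℝ^p. Let π be a uniformly random permutation of {1,…,p} and let w ∈ {−1,1}^p have i.i.d. Rademacher entries, with π and w independent. Define the OPORP sketches x, y ∈ ℝ^k by x_j = Σ_{l=(j−1)m+1}^{jm} w_l · u_{π^{−1}(l)} and y_j = Σ_{l=(j−1)m+1}^{jm} w_l · v_{π^{−1}(l)} for j = 1,…,k. Let a, b ∈ ℝ^k have i.i.d. N(0,σ²) entries, independent of π and w, and define ĝ = Σ_{j=1}^k (x_j + a_j)(y_j + b_j). Then E[ĝ] = Σ_{i=1}^p u_i v_i, and Var(ĝ) = σ²·Σ_{i=1}^p (u_i² + v_i²) + k·σ⁴ + (1/k)·( (Σ_{i=1}^p u_i²)(Σ_{i=1}^p v_i²) + (Σ_{i=1}^p u_i v_i)² − 2·Σ_{i=1}^p u_i² v_i² )·(p − k)/(p − 1). -/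

import Mathlib

open MeasureTheory ProbabilityTheory Real
open scoped ENNReal

/-- The Rademacher distribution on `ℝ`: `+1` or `−1`, each with probability `1/2`. -/
noncomputable def rademacher : Measure ℝ :=
  (2 : ℝ≥0∞)⁻¹ • (Measure.dirac 1 + Measure.dirac (-1))

instance : IsProbabilityMeasure rademacher := by
  constructor
  simp [rademacher, Measure.add_apply]
  rw [ENNReal.inv_two_add_inv_two]

instance {n : ℕ} : MeasurableSpace (Equiv.Perm (Fin n)) := ⊤

/-- The OPORP sketch of `u ∈ ℝᵖ` with permutation `π`, sign vector `w`, `k` bins of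
length `m = p/k`: the `j`-th output is `Σ_{l : ⌊l/m⌋ = j} w_l · u_{π⁻¹(l)}`. -/
noncomputable def oporp (p k : ℕ) (e : Equiv.Perm (Fin p)) (w : Fin p → ℝ)
    (u : Fin p → ℝ) (j : Fin k) : ℝ :=
  ∑ l ∈ Finset.univ.filter (fun l : Fin p => (l : ℕ) / (p / k) = (j : ℕ)),
    w l * u (e.symm l)

instance {n : ℕ} : DiscreteMeasurableSpace (Equiv.Perm (Fin n)) := ⟨fun _ => trivial⟩

/-- All moments finite. -/
def AllLp {Ω : Type*} [MeasurableSpace Ω] (μ : Measure Ω) (f : Ω → ℝ) : Prop :=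
  ∀ q : ℕ, 0 < q → MemLp f q μ

section alllp
variable {Ω : Type*} [MeasurableSpace Ω] {μ : Measure Ω}

lemma AllLp.add {f g : Ω → ℝ} (hf : AllLp μ f) (hg : AllLp μ g) :
    AllLp μ (fun z => f z + g z) := fun q hq => (hf q hq).add (hg q hq)

lemma AllLp.mul {f g : Ω → ℝ} (hf : AllLp μ f) (hg : AllLp μ g) :
    AllLp μ (fun z => f z * g z) := fun q hq => by
  have h1 := hf (2 * q) (by positivity)
  have h2 := hg (2 * q) (by positivity)
  have : ENNReal.HolderTriple ((2 * q : ℕ) : ℝ≥0∞) ((2 * q : ℕ) : ℝ≥0∞) (q : ℝ≥0∞) := by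
    constructor
    push_cast
    rw [ENNReal.mul_inv (by simp) (by simp), ← add_mul, ENNReal.inv_two_add_inv_two, one_mul]
  exact h2.mul h1

lemma AllLp.const [IsFiniteMeasure μ] (c : ℝ) : AllLp μ (fun _ => c) :=
  fun _ _ => memLp_const c

lemma AllLp.sum {ι : Type*} (s : Finset ι) {f : ι → Ω → ℝ} (hf : ∀ i, AllLp μ (f i)) :
    AllLp μ (fun z => ∑ i ∈ s, f i z) := fun q hq =>
  memLp_finsetSum s (fun i _ => hf i q hq)

lemma AllLp.sq {f : Ω → ℝ} (hf : AllLp μ f) : AllLp μ (fun z => f z ^ 2) := by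
  simpa only [pow_two] using hf.mul hf

lemma AllLp.integrable {f : Ω → ℝ} (hf : AllLp μ f) : Integrable f μ :=
  memLp_one_iff_integrable.1 (by simpa using hf 1 one_pos)

lemma AllLp.comp {Ω' : Type*} [MeasurableSpace Ω'] {ν : Measure Ω'} {f : Ω → ℝ} (hf : AllLp μ f)
    {t : Ω' → Ω} (ht : MeasurePreserving t ν μ) : AllLp ν (fun z => f (t z)) :=
  fun q hq => (hf q hq).comp_measurePreserving ht

lemma AllLp.eval {ι : Type*} [Fintype ι] {ν : Measure ℝ} [IsProbabilityMeasure ν]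
    (h : AllLp ν (fun x => x)) (i : ι) : AllLp (Measure.pi (fun _ : ι => ν)) (fun z => z i) :=
  h.comp (measurePreserving_eval (fun _ : ι => ν) i)

end alllp

lemma allLp_gauss (s : NNReal) : AllLp (gaussianReal 0 s) (fun x => x) := fun q _ =>
  memLp_id_gaussianReal' (q : ℝ≥0∞) (by simp)

lemma allLp_rad : AllLp rademacher (fun x => x) := fun q _ => by
  refine MemLp.of_bound (by fun_prop) 1 ?_
  unfold rademacher
  refine Measure.ae_smul_measure ?_ _
  rw [ae_add_measure_iff]
  simp [ae_dirac_eq]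

lemma allLp_perm {n : ℕ} {μ : Measure (Equiv.Perm (Fin n))} [IsFiniteMeasure μ]
    (f : Equiv.Perm (Fin n) → ℝ) : AllLp μ f := fun q _ => by
  refine MemLp.of_bound (by fun_prop) (∑ e, ‖f e‖) ?_
  refine Filter.Eventually.of_forall fun e => ?_
  exact Finset.single_le_sum (f := fun e => ‖f e‖) (fun _ _ => norm_nonneg _) (Finset.mem_univ e)

lemma rad_pow (n : ℕ) : ∫ x, x ^ n ∂rademacher = if Even n then 1 else 0 := by
  unfold rademacher
  rw [integral_smul_measure, integral_add_measure, integral_dirac, integral_dirac]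
  · split_ifs with h
    · simp [h.neg_one_pow]; norm_num
    · rw [Nat.not_even_iff_odd] at h
      simp [h.neg_one_pow]
  · exact integrable_dirac (by simp)
  · exact integrable_dirac (by simp)

lemma gauss_sq (s : NNReal) : ∫ x, x ^ 2 ∂(gaussianReal 0 s) = s := by
  have h := variance_id_gaussianReal (μ := 0) (v := s)
  rw [variance_eq_sub (memLp_id_gaussianReal' 2 (by simp))] at h
  simpa using h

lemma prod_pow_single {ι : Type*} [Fintype ι] [DecidableEq ι] (b : ι → ℝ) (i : ι) :
    ∏ t, b t ^ (if t = i then 1 else 0) = b i := by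
  simp [pow_ite]

section iid
variable {ι : Type*} [Fintype ι] [DecidableEq ι] {ν : Measure ℝ} [IsProbabilityMeasure ν]

lemma pi_mom1 (i : ι) : ∫ b, b i ∂(Measure.pi (fun _ : ι => ν)) = ∫ x, x ∂ν := by
  have := integral_comp_eval (μ := fun _ : ι => ν) (i := i) (f := fun x : ℝ => x) (by fun_prop)
  simpa using this

lemma pi_mom2 (h0 : ∫ x, x ∂ν = 0) (i j : ι) :
    ∫ b, b i * b j ∂(Measure.pi (fun _ : ι => ν)) = if i = j then ∫ x, x ^ 2 ∂ν else 0 := by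
  split_ifs with h
  · subst h
    have := integral_comp_eval (μ := fun _ : ι => ν) (i := i) (f := fun x : ℝ => x ^ 2) (by fun_prop)
    simpa [pow_two] using this
  · have h1 : ∀ b : ι → ℝ, b i * b j =
        ∏ t, (fun t (x : ℝ) => x ^ ((if t = i then 1 else 0) + (if t = j then 1 else 0))) t (b t) := by
      intro b
      simp only [pow_add, Finset.prod_mul_distrib, prod_pow_single]
    simp_rw [h1]
    rw [integral_fintype_prod_eq_prod (fun t (x : ℝ) => x ^ ((if t = i then 1 else 0) + (if t = j then 1 else 0)))]
    refine Finset.prod_eq_zero (Finset.mem_univ i) ?_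
    simp [h, h0]

/-- affine functional: mean -/
lemma aff1 (h : AllLp ν (fun x => x)) (h0 : ∫ x, x ∂ν = 0) (c : ι → ℝ) (d : ℝ) :
    ∫ b, (d + ∑ j, c j * b j) ∂(Measure.pi (fun _ : ι => ν)) = d := by
  rw [integral_add (by simp), integral_finsetSum]
  · simp [integral_const_mul, pi_mom1, h0]
  · intro i _; exact ((AllLp.const _).mul (h.eval i)).integrable
  · exact (AllLp.sum _ fun i => (AllLp.const _).mul (h.eval i)).integrable

lemma quad (h : AllLp ν (fun x => x)) (h0 : ∫ x, x ∂ν = 0) (c : ι → ι → ℝ) :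
    ∫ b, (∑ i, ∑ j, c i j * (b i * b j)) ∂(Measure.pi (fun _ : ι => ν)) =
      (∫ x, x ^ 2 ∂ν) * ∑ j, c j j := by
  rw [integral_finsetSum]
  · have : ∀ i : ι, ∫ b, (∑ j, c i j * (b i * b j)) ∂(Measure.pi (fun _ : ι => ν))
        = c i i * ∫ x, x ^ 2 ∂ν := by
      intro i
      rw [integral_finsetSum]
      · simp [integral_const_mul, pi_mom2 h0]
      · intro j _; exact ((AllLp.const _).mul ((h.eval i).mul (h.eval j))).integrable
    simp_rw [this, Finset.mul_sum, mul_comm]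
  · intro i _
    exact (AllLp.sum _ fun j => (AllLp.const _).mul ((h.eval i).mul (h.eval j))).integrable

lemma aff2 (h : AllLp ν (fun x => x)) (h0 : ∫ x, x ∂ν = 0) (c : ι → ℝ) (d : ℝ) :
    ∫ b, (d + ∑ j, c j * b j) ^ 2 ∂(Measure.pi (fun _ : ι => ν)) =
      d ^ 2 + (∫ x, x ^ 2 ∂ν) * ∑ j, c j ^ 2 := by
  have h1 : ∀ b : ι → ℝ, (d + ∑ j, c j * b j) ^ 2 =
      (d ^ 2 + ∑ j, (2 * d * c j) * b j) + ∑ i, ∑ j, (c i * c j) * (b i * b j) := by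
    intro b
    have : ∑ i, ∑ j, (c i * c j) * (b i * b j) = (∑ j, c j * b j) ^ 2 := by
      rw [pow_two, Finset.sum_mul_sum]
      exact Finset.sum_congr rfl fun i _ => Finset.sum_congr rfl fun j _ => by ring
    have h2 : ∑ j, (2 * d * c j) * b j = 2 * d * ∑ j, c j * b j := by
      rw [Finset.mul_sum]; exact Finset.sum_congr rfl fun i _ => by ring
    rw [this, h2]; ring
  simp_rw [h1]
  rw [integral_add, aff1 h h0, quad h h0]
  · simp [pow_two]
  · exact ((AllLp.const _).add (AllLp.sum _ fun i => (AllLp.const _).mul (h.eval i))).integrable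
  · exact (AllLp.sum _ fun i => AllLp.sum _ fun j => (AllLp.const _).mul ((h.eval i).mul (h.eval j))).integrable

end iid

lemma rad_mom4 {ι : Type*} [Fintype ι] [DecidableEq ι] (i j k l : ι) :
    ∫ b, (b i * b j) * (b k * b l) ∂(Measure.pi (fun _ : ι => rademacher)) =
      (if i = j then (if k = l then 1 else 0) else 0) + (if i = k then (if j = l then 1 else 0) else 0)
      + (if i = l then (if j = k then 1 else 0) else 0)
      - 2 * (if i = j then (if k = l then (if i = k then 1 else 0) else 0) else 0 : ℝ) := by
  have h1 : ∀ b : ι → ℝ, (b i * b j) * (b k * b l) =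
      ∏ t, (fun t (x : ℝ) => x ^ (((if t = i then 1 else 0) + (if t = j then 1 else 0))
        + ((if t = k then 1 else 0) + (if t = l then 1 else 0)))) t (b t) := by
    intro b
    simp only [pow_add, Finset.prod_mul_distrib, prod_pow_single]
  simp_rw [h1]
  rw [integral_fintype_prod_eq_prod (fun t (x : ℝ) => x ^ (((if t = i then 1 else 0) + (if t = j then 1 else 0))
        + ((if t = k then 1 else 0) + (if t = l then 1 else 0))))]
  simp_rw [rad_pow]
  rw [Finset.prod_ite_zero]
  simp only [Finset.mem_univ, true_implies, Finset.prod_const_one]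
  by_cases hij : i = j
  · subst hij
    by_cases hkl : k = l
    · subst hkl
      rw [if_pos]
      · by_cases hik : i = k <;> simp [hik]; norm_num
      · intro t; exact (Even.add (by simp) (by simp))
    · rw [if_neg]
      · by_cases hik : i = k
        · subst hik; simp [hkl]
        · simp [hkl, hik]
      · intro hh
        have := hh k
        by_cases hik : k = i <;> simp [hkl, hik] at this
        · subst hik; simp [hkl] at this
          revert this; decide
  · by_cases hkl : k = l
    · subst hkl
      rw [if_neg]
      · by_cases hik : i = k
        · subst hik; simp [hij, Ne.symm hij]
        · simp [hij, hik]
      · intro hh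
        have := hh i
        by_cases hik : i = k <;> simp [hij, hik] at this
        · subst hik; simp [hij] at this
          revert this; decide
    · by_cases hik : i = k
      · subst hik
        by_cases hjl : j = l
        · subst hjl
          rw [if_pos]
          · simp [hij]
          · intro t; exact ⟨_, rfl⟩
        · rw [if_neg]
          · simp [hij, hjl, hkl]
          · intro hh
            have := hh j
            simp [Ne.symm hij, hjl] at this
      · by_cases hil : i = l
        · subst hil
          by_cases hjk : j = k
          · subst hjk
            rw [if_pos]
            · simp [hij]
            · intro t; exact ⟨(if t = i then 1 else 0) + (if t = j then 1 else 0), by ring⟩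
          · rw [if_neg]
            · simp [hij, hjk, hik]
            · intro hh
              have := hh j
              simp [Ne.symm hij, hjk] at this
        · rw [if_neg]
          · simp [hij, hik, hil]
          · intro hh
            have := hh i
            simp [hij, hik, hil] at this

section inner
variable {k : ℕ} {ν : Measure ℝ} [IsProbabilityMeasure ν]

lemma g_allLp {Ω : Type*} [MeasurableSpace Ω] {μ : Measure Ω} {x y a b : Fin k → Ω → ℝ}
    (hx : ∀ j, AllLp μ (x j)) (hy : ∀ j, AllLp μ (y j)) (ha : ∀ j, AllLp μ (a j))
    (hb : ∀ j, AllLp μ (b j)) :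
    AllLp μ (fun z => ∑ j, (x j z + a j z) * (y j z + b j z)) :=
  AllLp.sum _ fun j => ((hx j).add (ha j)).mul ((hy j).add (hb j))

lemma ab_allLp (h : AllLp ν (fun x => x)) (x y : Fin k → ℝ) :
    AllLp ((Measure.pi (fun _ : Fin k => ν)).prod (Measure.pi (fun _ : Fin k => ν)))
      (fun z => ∑ j, (x j + z.1 j) * (y j + z.2 j)) :=
  g_allLp (x := fun j _ => x j) (y := fun j _ => y j) (a := fun j (z : (Fin k → ℝ) × (Fin k → ℝ)) => z.1 j)
    (b := fun j (z : (Fin k → ℝ) × (Fin k → ℝ)) => z.2 j)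
    (fun j => AllLp.const _) (fun j => AllLp.const _)
    (fun j => (h.eval j).comp measurePreserving_fst) (fun j => (h.eval j).comp measurePreserving_snd)

lemma inner1 (h : AllLp ν (fun x => x)) (h0 : ∫ x, x ∂ν = 0) (x y : Fin k → ℝ) :
    ∫ z, ∑ j, (x j + z.1 j) * (y j + z.2 j)
      ∂((Measure.pi (fun _ : Fin k => ν)).prod (Measure.pi (fun _ : Fin k => ν)))
      = ∑ j, x j * y j := by
  rw [integral_prod _ (ab_allLp h x y).integrable]
  have h1 : ∀ a b : Fin k → ℝ, ∑ j, (x j + a j) * (y j + b j) =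
      (∑ j, (x j + a j) * y j) + ∑ j, (x j + a j) * b j := by
    intro a b; rw [← Finset.sum_add_distrib]; exact Finset.sum_congr rfl fun _ _ => by ring
  have h2 : ∀ a : Fin k → ℝ, ∑ j, (x j + a j) * y j =
      (∑ j, x j * y j) + ∑ j, y j * a j := by
    intro a; rw [← Finset.sum_add_distrib]; exact Finset.sum_congr rfl fun _ _ => by ring
  simp_rw [h1, aff1 h h0, h2, aff1 h h0]

lemma inner2 (h : AllLp ν (fun x => x)) (h0 : ∫ x, x ∂ν = 0) (x y : Fin k → ℝ) :
    ∫ z, (∑ j, (x j + z.1 j) * (y j + z.2 j)) ^ 2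
      ∂((Measure.pi (fun _ : Fin k => ν)).prod (Measure.pi (fun _ : Fin k => ν)))
      = (∑ j, x j * y j) ^ 2 + (∫ x, x ^ 2 ∂ν) * (∑ j, x j * x j + ∑ j, y j * y j)
        + k * (∫ x, x ^ 2 ∂ν) ^ 2 := by
  rw [integral_prod _ (ab_allLp h x y).sq.integrable]
  have h1 : ∀ a b : Fin k → ℝ, ∑ j, (x j + a j) * (y j + b j) =
      (∑ j, (x j + a j) * y j) + ∑ j, (x j + a j) * b j := by
    intro a b; rw [← Finset.sum_add_distrib]; exact Finset.sum_congr rfl fun _ _ => by ring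
  have h2 : ∀ a : Fin k → ℝ, ∑ j, (x j + a j) * y j =
      (∑ j, x j * y j) + ∑ j, y j * a j := by
    intro a; rw [← Finset.sum_add_distrib]; exact Finset.sum_congr rfl fun _ _ => by ring
  have hl : AllLp (Measure.pi (fun _ : Fin k => ν))
      (fun a => ∑ j, x j * y j + ∑ j, y j * a j) :=
    (AllLp.const _).add (AllLp.sum _ fun j => (AllLp.const _).mul (h.eval j))
  have hs : ∀ j, AllLp (Measure.pi (fun _ : Fin k => ν)) (fun a => (x j + a j) ^ 2) :=
    fun j => ((AllLp.const _).add (h.eval j)).sq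
  have h3 : ∀ j : Fin k, ∫ a, (x j + a j) ^ 2 ∂(Measure.pi (fun _ : Fin k => ν))
      = x j ^ 2 + ∫ x, x ^ 2 ∂ν := by
    intro j
    have := aff2 h h0 (fun i => if i = j then 1 else 0) (x j)
    simpa [ite_pow] using this
  simp_rw [h1, aff2 h h0, h2]
  rw [integral_add hl.sq.integrable ((AllLp.const _).mul (AllLp.sum _ hs)).integrable,
    aff2 h h0, integral_const_mul, integral_finsetSum _ (fun j _ => (hs j).integrable)]
  simp_rw [h3, Finset.sum_add_distrib]
  simp [pow_two]
  ring

end inner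

/-- fourth moments: second moment of a Rademacher quadratic form -/
lemma rad_quad_sq {ι : Type*} [Fintype ι] [DecidableEq ι] (A : ι → ι → ℝ) :
    ∫ b, (∑ i, ∑ j, A i j * (b i * b j)) ^ 2 ∂(Measure.pi (fun _ : ι => rademacher)) =
      (∑ i, A i i) ^ 2 + ∑ i, ∑ j, (A i j * A i j + A i j * A j i) - 2 * ∑ i, A i i * A i i := by
  have h1 : ∀ b : ι → ℝ, (∑ i, ∑ j, A i j * (b i * b j)) ^ 2 =
      ∑ i, ∑ j, ∑ k, ∑ l, (A i j * A k l) * ((b i * b j) * (b k * b l)) := by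
    intro b
    rw [pow_two]
    simp_rw [Finset.sum_mul, Finset.mul_sum]
    refine Finset.sum_congr rfl fun i _ => Finset.sum_congr rfl fun j _ =>
      Finset.sum_congr rfl fun k _ => Finset.sum_congr rfl fun l _ => by ring
  have hI : ∀ i j k l : ι, AllLp (Measure.pi (fun _ : ι => rademacher))
      (fun b => (A i j * A k l) * ((b i * b j) * (b k * b l))) := fun i j k l =>
    (AllLp.const _).mul (((allLp_rad.eval i).mul (allLp_rad.eval j)).mul
      ((allLp_rad.eval k).mul (allLp_rad.eval l)))
  simp_rw [h1]
  rw [integral_finsetSum _ (fun i _ => (AllLp.sum _ fun j => AllLp.sum _ fun k => AllLp.sum _ fun l => hI i j k l).integrable)]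
  simp_rw [integral_finsetSum _ (fun j _ => (AllLp.sum _ fun k => AllLp.sum _ fun l => hI _ j k l).integrable),
    integral_finsetSum _ (fun k _ => (AllLp.sum _ fun l => hI _ _ k l).integrable),
    integral_finsetSum _ (fun l _ => (hI _ _ _ l).integrable), integral_const_mul, rad_mom4]
  simp only [mul_sub, mul_add, mul_ite, mul_zero, mul_one, Finset.sum_sub_distrib, Finset.sum_add_distrib]
  simp [pow_two, Finset.sum_mul_sum, Finset.sum_ite_irrel]
  rw [Finset.mul_sum]
  simp_rw [mul_comm]
  ring

/-- transitivity on ordered pairs -/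
lemma exists_perm2 {n : ℕ} {i j i' j' : Fin n} (h : i ≠ j) (h' : i' ≠ j') :
    ∃ τ : Equiv.Perm (Fin n), τ i = i' ∧ τ j = j' := by
  refine ⟨(Equiv.swap i i').trans (Equiv.swap (Equiv.swap i i' j) j'), ?_, ?_⟩
  · simp only [Equiv.trans_apply, Equiv.swap_apply_left]
    refine Equiv.swap_apply_of_ne_of_ne ?_ h'
    intro hh
    apply h
    have := congrArg (Equiv.swap i i') hh
    simpa using this
  · simp

lemma perm_sum_const {n : ℕ} (f : Fin n → Fin n → ℝ) {i j i' j' : Fin n} (h : i ≠ j) (h' : i' ≠ j') :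
    ∑ e : Equiv.Perm (Fin n), f (e.symm i) (e.symm j) =
      ∑ e : Equiv.Perm (Fin n), f (e.symm i') (e.symm j') := by
  obtain ⟨τ, h1, h2⟩ := exists_perm2 h h'
  rw [← Equiv.sum_comp (Equiv.mulLeft τ) (fun e : Equiv.Perm (Fin n) => f (e.symm i') (e.symm j'))]
  refine Finset.sum_congr rfl fun e _ => ?_
  subst h1 h2
  change f _ _ = f (e.symm (τ.symm (τ i))) (e.symm (τ.symm (τ j)))
  simp

lemma off_sum {n : ℕ} (f : Fin n → Fin n → ℝ) :
    ∑ i, ∑ j, (if i ≠ j then f i j else 0) = ∑ i, ∑ j, f i j - ∑ i, f i i := by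
  rw [← Finset.sum_sub_distrib]
  refine Finset.sum_congr rfl fun i _ => ?_
  have : ∀ j, (if i ≠ j then f i j else 0) = f i j - if i = j then f i j else 0 := by
    intro j; by_cases h : i = j <;> simp [h]
  simp [this, Finset.sum_sub_distrib]

lemma perm_avg {n : ℕ} (f : Fin n → Fin n → ℝ) {i j : Fin n} (h : i ≠ j) :
    ((n : ℝ) * n - n) * ∑ e : Equiv.Perm (Fin n), f (e.symm i) (e.symm j) =
      (n.factorial : ℝ) * (∑ a, ∑ b, f a b - ∑ a, f a a) := by
  have h1 : ∑ i' : Fin n, ∑ j' : Fin n, (if i' ≠ j' then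
      ∑ e : Equiv.Perm (Fin n), f (e.symm i') (e.symm j') else 0) =
      ∑ i' : Fin n, ∑ j' : Fin n, (if i' ≠ j' then
        ∑ e : Equiv.Perm (Fin n), f (e.symm i) (e.symm j) else 0) := by
    refine Finset.sum_congr rfl fun i' _ => Finset.sum_congr rfl fun j' _ => ?_
    split_ifs with hh
    · exact perm_sum_const f hh h
    · rfl
  rw [off_sum (fun i' j' => ∑ e : Equiv.Perm (Fin n), f (e.symm i') (e.symm j')),
    off_sum (fun _ _ => ∑ e : Equiv.Perm (Fin n), f (e.symm i) (e.symm j))] at h1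
  have h2 : ∑ i', ∑ j', ∑ e : Equiv.Perm (Fin n), f (e.symm i') (e.symm j') =
      (n.factorial : ℝ) * ∑ a, ∑ b, f a b := by
    have : ∀ e : Equiv.Perm (Fin n), ∑ i', ∑ j', f (e.symm i') (e.symm j') = ∑ a, ∑ b, f a b := by
      intro e
      rw [← Equiv.sum_comp e.symm (fun a => ∑ b, f a b)]
      exact Finset.sum_congr rfl fun i' _ => Equiv.sum_comp e.symm (fun b => f (e.symm i') b)
    simp_rw [Finset.sum_comm (s := Finset.univ (α := Fin n)) (t := Finset.univ (α := Equiv.Perm (Fin n)))]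
    simp [this, Fintype.card_perm]
  have h3 : ∑ i', ∑ e : Equiv.Perm (Fin n), f (e.symm i') (e.symm i') =
      (n.factorial : ℝ) * ∑ a, f a a := by
    rw [Finset.sum_comm]
    have : ∀ e : Equiv.Perm (Fin n), ∑ i', f (e.symm i') (e.symm i') = ∑ a, f a a :=
      fun e => Equiv.sum_comp e.symm (fun a => f a a)
    simp [this, Fintype.card_perm]
  rw [h2, h3] at h1
  simp only [Finset.sum_const, Finset.card_univ, Fintype.card_fin, nsmul_eq_mul] at h1
  linarith

lemma bin_card {p k : ℕ} (hkp : k ∣ p) (hp : 0 < p) (i : Fin p) :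
    (Finset.univ.filter (fun l : Fin p => (i : ℕ) / (p / k) = (l : ℕ) / (p / k))).card = p / k := by
  obtain ⟨m, rfl⟩ := hkp
  have hk : 0 < k := Nat.pos_of_mul_pos_right hp
  have hm : 0 < m := Nat.pos_of_mul_pos_left hp
  rw [Nat.mul_div_cancel_left m hk]
  have hi := i.2
  have hq : (i : ℕ) / m < k := (Nat.div_lt_iff_lt_mul hm).2 hi
  rw [← Finset.card_map Fin.valEmbedding]
  have : (Finset.univ.filter (fun l : Fin (k * m) => (i : ℕ) / m = (l : ℕ) / m)).map Fin.valEmbedding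
      = Finset.Ico ((i : ℕ) / m * m) ((i : ℕ) / m * m + m) := by
    ext t
    simp only [Finset.mem_map, Finset.mem_filter, Finset.mem_univ, true_and, Finset.mem_Ico,
      Fin.valEmbedding_apply]
    constructor
    · rintro ⟨l, h, rfl⟩
      rw [h]
      exact ⟨Nat.div_mul_le_self _ _, Nat.lt_div_mul_add hm⟩
    · rintro ⟨h1, h2⟩
      refine ⟨⟨t, ?_⟩, ?_, rfl⟩
      · have : ((i : ℕ) / m + 1) * m ≤ k * m := Nat.mul_le_mul_right m hq
        linarith
      · simp only
        refine (Nat.div_eq_of_lt_le h1 ?_).symm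
        linarith
  rw [this]; simp

lemma bins_avg {p k : ℕ} (hkp : k ∣ p) (hp : 1 < p) (f : Fin p → Fin p → ℝ) :
    ((p : ℝ) - 1) * ∑ e : Equiv.Perm (Fin p),
      (∑ i : Fin p, ∑ j : Fin p, (if (i : ℕ) / (p / k) = (j : ℕ) / (p / k)
          then f (e.symm i) (e.symm j) else 0) - ∑ i, f i i) =
      (p.factorial : ℝ) * (((p / k : ℕ) : ℝ) - 1) * (∑ a, ∑ b, f a b - ∑ a, f a a) := by
  have hp0 : (p : ℝ) ≠ 0 := by positivity
  have h1 : ∀ e : Equiv.Perm (Fin p),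
      (∑ i : Fin p, ∑ j : Fin p, (if (i : ℕ) / (p / k) = (j : ℕ) / (p / k)
          then f (e.symm i) (e.symm j) else 0) - ∑ i, f i i) =
      ∑ i : Fin p, ∑ j : Fin p, (if i ≠ j then (if (i : ℕ) / (p / k) = (j : ℕ) / (p / k)
          then f (e.symm i) (e.symm j) else 0) else 0) := by
    intro e
    rw [off_sum (fun i j : Fin p => (if (i : ℕ) / (p / k) = (j : ℕ) / (p / k)
          then f (e.symm i) (e.symm j) else 0))]
    simp [Equiv.sum_comp e.symm (fun i => f i i)]
  simp_rw [h1]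
  rw [Finset.sum_comm]
  simp_rw [Finset.sum_comm (s := Finset.univ (α := Equiv.Perm (Fin p)))]
  have h2 : ∀ i j : Fin p, ((p : ℝ) * p - p) * ∑ e : Equiv.Perm (Fin p),
      (if i ≠ j then (if (i : ℕ) / (p / k) = (j : ℕ) / (p / k)
          then f (e.symm i) (e.symm j) else 0) else 0) =
      if i ≠ j then (if (i : ℕ) / (p / k) = (j : ℕ) / (p / k) then
        (p.factorial : ℝ) * (∑ a, ∑ b, f a b - ∑ a, f a a) else 0) else 0 := by
    intro i j
    by_cases hij : i = j
    · simp [hij]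
    · by_cases hb : (i : ℕ) / (p / k) = (j : ℕ) / (p / k)
      · simp only [ne_eq, hij, not_false_eq_true, if_true, hb]
        exact perm_avg f hij
      · simp [hb]
  refine mul_left_cancel₀ hp0 ?_
  rw [← mul_assoc, show (p : ℝ) * (p - 1) = p * p - p by ring, Finset.mul_sum]
  rw [Finset.sum_congr rfl fun i _ => (Finset.mul_sum _ _ _).trans
    (Finset.sum_congr rfl fun j _ => h2 i j)]
  rw [off_sum (fun i j : Fin p => if (i : ℕ) / (p / k) = (j : ℕ) / (p / k) then
        (p.factorial : ℝ) * (∑ a, ∑ b, f a b - ∑ a, f a a) else 0)]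
  simp_rw [← Finset.sum_filter, Finset.sum_const, bin_card hkp (by omega : 0 < p)]
  simp
  ring

lemma oporp_quad {p k : ℕ} (hkp : k ∣ p) (hp : 0 < p) (e : Equiv.Perm (Fin p)) (w u v : Fin p → ℝ) :
    ∑ j, oporp p k e w u j * oporp p k e w v j =
      ∑ i : Fin p, ∑ l : Fin p, (if (i : ℕ) / (p / k) = (l : ℕ) / (p / k) then
        u (e.symm i) * v (e.symm l) else 0) * (w i * w l) := by
  have hlt : ∀ i : Fin p, (i : ℕ) / (p / k) < k := by
    intro i
    obtain ⟨m, rfl⟩ := hkp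
    have hk : 0 < k := Nat.pos_of_mul_pos_right hp
    have hm : 0 < m := Nat.pos_of_mul_pos_left hp
    rw [Nat.mul_div_cancel_left m hk]
    exact (Nat.div_lt_iff_lt_mul hm).2 i.2
  obtain ⟨c, hc⟩ : ∃ c : Fin p → Fin k, ∀ i, (c i : ℕ) = (i : ℕ) / (p / k) :=
    ⟨fun i => ⟨_, hlt i⟩, fun i => rfl⟩
  unfold oporp
  simp_rw [← hc, Fin.val_inj, Finset.sum_filter, Finset.sum_mul_sum]
  rw [Finset.sum_comm]
  refine Finset.sum_congr rfl fun i _ => ?_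
  rw [Finset.sum_comm]
  refine Finset.sum_congr rfl fun l _ => ?_
  simp only [ite_mul, zero_mul, Finset.sum_ite_eq, Finset.mem_univ, if_true, mul_ite, mul_zero]
  by_cases h : c i = c l
  · simp [h]; ring
  · simp [h, Ne.symm h]

lemma rad0 : ∫ x, x ∂rademacher = 0 := by simpa using rad_pow 1

lemma rad2 : ∫ x, x ^ 2 ∂rademacher = 1 := by simpa using rad_pow 2

section levels
variable {p k : ℕ} {ν : Measure ℝ} [IsProbabilityMeasure ν]

lemma full_allLp (hν : AllLp ν (fun x => x)) (U : Measure (Equiv.Perm (Fin p)))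
    [IsProbabilityMeasure U] (u v : Fin p → ℝ) :
    AllLp (U.prod ((Measure.pi (fun _ : Fin p => rademacher)).prod
      ((Measure.pi (fun _ : Fin k => ν)).prod (Measure.pi (fun _ : Fin k => ν)))))
      (fun z => ∑ j : Fin k,
          (oporp p k z.1 z.2.1 u j + z.2.2.1 j) * (oporp p k z.1 z.2.1 v j + z.2.2.2 j)) := by
  have ho : ∀ (u : Fin p → ℝ) (j : Fin k), AllLp (U.prod ((Measure.pi (fun _ : Fin p => rademacher)).prod
      ((Measure.pi (fun _ : Fin k => ν)).prod (Measure.pi (fun _ : Fin k => ν)))))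
      (fun z => oporp p k z.1 z.2.1 u j) := fun u j =>
    AllLp.sum _ fun l => (((allLp_rad.eval l).comp measurePreserving_fst).comp
      measurePreserving_snd).mul
        ((allLp_perm (fun e => u (e.symm l))).comp measurePreserving_fst)
  exact AllLp.sum _ fun j => ((ho u j).add
    ((((hν.eval j).comp measurePreserving_fst).comp measurePreserving_snd).comp
      measurePreserving_snd)).mul ((ho v j).add
    ((((hν.eval j).comp measurePreserving_snd).comp measurePreserving_snd).comp
      measurePreserving_snd))

lemma oporp_allLp (e : Equiv.Perm (Fin p)) (u : Fin p → ℝ) (j : Fin k) :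
    AllLp (Measure.pi (fun _ : Fin p => rademacher)) (fun w => oporp p k e w u j) :=
  AllLp.sum _ fun l => (allLp_rad.eval l).mul (AllLp.const _)

lemma sec_allLp (hν : AllLp ν (fun x => x)) (e : Equiv.Perm (Fin p)) (u v : Fin p → ℝ) :
    AllLp ((Measure.pi (fun _ : Fin p => rademacher)).prod
      ((Measure.pi (fun _ : Fin k => ν)).prod (Measure.pi (fun _ : Fin k => ν))))
      (fun z => ∑ j : Fin k,
          (oporp p k e z.1 u j + z.2.1 j) * (oporp p k e z.1 v j + z.2.2 j)) :=
  AllLp.sum _ fun j => (((oporp_allLp e u j).comp measurePreserving_fst).add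
    (((hν.eval j).comp measurePreserving_fst).comp measurePreserving_snd)).mul
    (((oporp_allLp e v j).comp measurePreserving_fst).add
    (((hν.eval j).comp measurePreserving_snd).comp measurePreserving_snd))

lemma oporp_mean (hkp : k ∣ p) (hp : 0 < p) (e : Equiv.Perm (Fin p)) (u v : Fin p → ℝ) :
    ∫ w, ∑ j : Fin k, oporp p k e w u j * oporp p k e w v j
      ∂(Measure.pi (fun _ : Fin p => rademacher)) = ∑ i, u i * v i := by
  simp_rw [oporp_quad hkp hp]
  rw [quad allLp_rad rad0, rad2]
  simp [Equiv.sum_comp e.symm (fun i => u i * v i)]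

lemma oporp_sq (hkp : k ∣ p) (hp : 0 < p) (e : Equiv.Perm (Fin p)) (u v : Fin p → ℝ) :
    ∫ w, (∑ j : Fin k, oporp p k e w u j * oporp p k e w v j) ^ 2
      ∂(Measure.pi (fun _ : Fin p => rademacher)) = (∑ i, u i * v i) ^ 2 +
      (∑ i : Fin p, ∑ j : Fin p, (if (i : ℕ) / (p / k) = (j : ℕ) / (p / k) then
        (fun a b => u a * v b * (u a * v b) + u a * v b * (u b * v a)) (e.symm i) (e.symm j) else 0)
        - ∑ i, (fun a b => u a * v b * (u a * v b) + u a * v b * (u b * v a)) i i) := by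
  simp_rw [oporp_quad hkp hp]
  rw [rad_quad_sq]
  have h1 : ∀ i j : Fin p,
      ((if (i : ℕ) / (p / k) = (j : ℕ) / (p / k) then u (e.symm i) * v (e.symm j) else 0) *
       (if (i : ℕ) / (p / k) = (j : ℕ) / (p / k) then u (e.symm i) * v (e.symm j) else 0) +
       (if (i : ℕ) / (p / k) = (j : ℕ) / (p / k) then u (e.symm i) * v (e.symm j) else 0) *
       (if (j : ℕ) / (p / k) = (i : ℕ) / (p / k) then u (e.symm j) * v (e.symm i) else 0)) =
      (if (i : ℕ) / (p / k) = (j : ℕ) / (p / k) then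
        (fun a b => u a * v b * (u a * v b) + u a * v b * (u b * v a)) (e.symm i) (e.symm j) else 0) := by
    intro i j
    by_cases h : (i : ℕ) / (p / k) = (j : ℕ) / (p / k)
    · simp [h]
    · simp [h]
  simp_rw [h1]
  simp only [if_true]
  rw [Equiv.sum_comp e.symm (fun i => u i * v i),
    Equiv.sum_comp e.symm (fun i => u i * v i * (u i * v i)), Finset.sum_add_distrib]
  ring

lemma mid1 (hkp : k ∣ p) (hp : 0 < p) (hν : AllLp ν (fun x => x)) (h0 : ∫ x, x ∂ν = 0)
    (e : Equiv.Perm (Fin p)) (u v : Fin p → ℝ) :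
    ∫ z, (∑ j : Fin k, (oporp p k e z.1 u j + z.2.1 j) * (oporp p k e z.1 v j + z.2.2 j))
      ∂((Measure.pi (fun _ : Fin p => rademacher)).prod
      ((Measure.pi (fun _ : Fin k => ν)).prod (Measure.pi (fun _ : Fin k => ν)))) =
      ∑ i, u i * v i := by
  rw [integral_prod _ (sec_allLp hν e u v).integrable]
  simp_rw [inner1 hν h0]
  exact oporp_mean hkp hp e u v

lemma mid2 (hkp : k ∣ p) (hp : 0 < p) (hν : AllLp ν (fun x => x)) (h0 : ∫ x, x ∂ν = 0)
    (e : Equiv.Perm (Fin p)) (u v : Fin p → ℝ) :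
    ∫ z, (∑ j : Fin k, (oporp p k e z.1 u j + z.2.1 j) * (oporp p k e z.1 v j + z.2.2 j)) ^ 2
      ∂((Measure.pi (fun _ : Fin p => rademacher)).prod
      ((Measure.pi (fun _ : Fin k => ν)).prod (Measure.pi (fun _ : Fin k => ν)))) =
      (∑ i, u i * v i) ^ 2 + (∫ x, x ^ 2 ∂ν) * (∑ i, u i * u i + ∑ i, v i * v i)
        + k * (∫ x, x ^ 2 ∂ν) ^ 2 +
      (∑ i : Fin p, ∑ j : Fin p, (if (i : ℕ) / (p / k) = (j : ℕ) / (p / k) then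
        (fun a b => u a * v b * (u a * v b) + u a * v b * (u b * v a)) (e.symm i) (e.symm j) else 0)
        - ∑ i, (fun a b => u a * v b * (u a * v b) + u a * v b * (u b * v a)) i i) := by
  have hT : ∀ u v : Fin p → ℝ, AllLp (Measure.pi (fun _ : Fin p => rademacher))
      (fun w => ∑ j : Fin k, oporp p k e w u j * oporp p k e w v j) := fun u v =>
    AllLp.sum _ fun j => (oporp_allLp e u j).mul (oporp_allLp e v j)
  rw [integral_prod _ (sec_allLp hν e u v).sq.integrable]
  simp_rw [inner2 hν h0]
  rw [integral_add ((hT u v).sq.add ((AllLp.const _).mul ((hT u u).add (hT v v)))).integrable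
      (AllLp.const _).integrable,
    integral_add (hT u v).sq.integrable ((AllLp.const _).mul ((hT u u).add (hT v v))).integrable,
    integral_const_mul, integral_add (hT u u).integrable (hT v v).integrable,
    oporp_mean hkp hp, oporp_mean hkp hp, oporp_sq hkp hp]
  simp
  ring

end levels

/-- **DP-OPORP inner product estimation.** With a uniformly random permutation `π`, an
i.i.d. Rademacher vector `w`, OPORP sketches `x, y` of `u, v`, and independent Gaussian
noise vectors `a, b` with entries `N(0,σ²)`, the estimator `ĝ = Σⱼ (xⱼ + aⱼ)(yⱼ + bⱼ)`
satisfies `E[ĝ] = Σᵢ uᵢvᵢ` and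
`Var(ĝ) = σ²Σᵢ(uᵢ²+vᵢ²) + kσ⁴ + (1/k)((Σuᵢ²)(Σvᵢ²) + (Σuᵢvᵢ)² − 2Σuᵢ²vᵢ²)·(p−k)/(p−1)`. -/
theorem dp_oporp_inner_product (p k : ℕ) (hk : 0 < k) (hkp : k ∣ p) (hp : 1 < p)
    (σ : ℝ) (hσ : 0 < σ) (u v : Fin p → ℝ) :
    (∫ z : Equiv.Perm (Fin p) × ((Fin p → ℝ) × ((Fin k → ℝ) × (Fin k → ℝ))),
        (∑ j : Fin k,
          (oporp p k z.1 z.2.1 u j + z.2.2.1 j) * (oporp p k z.1 z.2.1 v j + z.2.2.2 j))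
        ∂(Measure.prod
            (PMF.uniformOfFintype (Equiv.Perm (Fin p))).toMeasure
            (Measure.prod
              (Measure.pi (fun _ : Fin p => rademacher))
              (Measure.prod
                (Measure.pi (fun _ : Fin k => gaussianReal 0 ⟨σ ^ 2, sq_nonneg σ⟩))
                (Measure.pi (fun _ : Fin k => gaussianReal 0 ⟨σ ^ 2, sq_nonneg σ⟩))))))
      = ∑ i : Fin p, u i * v i
    ∧ variance
        (fun z : Equiv.Perm (Fin p) × ((Fin p → ℝ) × ((Fin k → ℝ) × (Fin k → ℝ))) =>
          ∑ j : Fin k,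
            (oporp p k z.1 z.2.1 u j + z.2.2.1 j) * (oporp p k z.1 z.2.1 v j + z.2.2.2 j))
        (Measure.prod
            (PMF.uniformOfFintype (Equiv.Perm (Fin p))).toMeasure
            (Measure.prod
              (Measure.pi (fun _ : Fin p => rademacher))
              (Measure.prod
                (Measure.pi (fun _ : Fin k => gaussianReal 0 ⟨σ ^ 2, sq_nonneg σ⟩))
                (Measure.pi (fun _ : Fin k => gaussianReal 0 ⟨σ ^ 2, sq_nonneg σ⟩)))))
      = σ ^ 2 * ∑ i : Fin p, (u i ^ 2 + v i ^ 2) + k * σ ^ 4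
          + (1 / k) * ((∑ i : Fin p, u i ^ 2) * (∑ i : Fin p, v i ^ 2)
              + (∑ i : Fin p, u i * v i) ^ 2 - 2 * ∑ i : Fin p, u i ^ 2 * v i ^ 2)
            * ((p : ℝ) - k) / ((p : ℝ) - 1) := by
  have hp0 : 0 < p := by omega
  obtain ⟨s, hs⟩ : ∃ s : NNReal, s = ⟨σ ^ 2, sq_nonneg σ⟩ := ⟨_, rfl⟩
  have hsv : (s : ℝ) = σ ^ 2 := by rw [hs]; rfl
  rw [← hs]
  have hν := allLp_gauss s
  have h0 : ∫ x, x ∂(gaussianReal 0 s) = 0 := integral_id_gaussianReal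
  have hL := full_allLp (p := p) (k := k) (ν := gaussianReal 0 s) hν
    (PMF.uniformOfFintype (Equiv.Perm (Fin p))).toMeasure u v
  have hfac : (p.factorial : ℝ) ≠ 0 := by positivity
  have hE : ∀ F : Equiv.Perm (Fin p) → ℝ,
      ∫ e, F e ∂(PMF.uniformOfFintype (Equiv.Perm (Fin p))).toMeasure
        = (p.factorial : ℝ)⁻¹ * ∑ e, F e := by
    intro F
    rw [PMF.integral_eq_sum, Finset.mul_sum]
    simp [Fintype.card_perm]
  have hmean := integral_prod _ hL.integrable
  simp_rw [mid1 hkp hp0 hν h0] at hmean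
  simp only [integral_const, probReal_univ, one_smul] at hmean
  refine ⟨hmean, ?_⟩
  have hM2 : MemLp _ 2 _ := hL 2 two_pos
  rw [variance_eq_sub hM2, hmean]
  have hsq := integral_prod _ hL.sq.integrable
  simp only [Pi.pow_apply]
  rw [hsq]
  simp_rw [mid2 hkp hp0 hν h0, gauss_sq]
  rw [hE]
  have hb := bins_avg (k := k) hkp hp
    (fun a b => u a * v b * (u a * v b) + u a * v b * (u b * v a))
  rw [Finset.sum_add_distrib, Finset.sum_const, Finset.card_univ, Fintype.card_perm,
    Fintype.card_fin, nsmul_eq_mul, mul_add, inv_mul_cancel_left₀ hfac]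
  have hp1 : (p : ℝ) - 1 ≠ 0 := by
    have : (1 : ℝ) < p := by exact_mod_cast hp
    linarith
  have hk0 : (k : ℝ) ≠ 0 := by positivity
  rw [Nat.cast_div hkp hk0] at hb
  have hF : (∑ a, ∑ b, (fun a b => u a * v b * (u a * v b) + u a * v b * (u b * v a)) a b
      - ∑ a, (fun a b => u a * v b * (u a * v b) + u a * v b * (u b * v a)) a a) =
      (∑ i : Fin p, u i ^ 2) * (∑ i : Fin p, v i ^ 2)
              + (∑ i : Fin p, u i * v i) ^ 2 - 2 * ∑ i : Fin p, u i ^ 2 * v i ^ 2 := by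
    rw [pow_two (∑ i : Fin p, u i * v i), Finset.sum_mul_sum, Finset.sum_mul_sum, Finset.mul_sum]
    simp only [← Finset.sum_add_distrib]
    congr 1
    · exact Finset.sum_congr rfl fun i _ => Finset.sum_congr rfl fun j _ => by ring
    · exact Finset.sum_congr rfl fun i _ => by ring
  rw [hF] at hb
  rw [eq_div_of_mul_eq hp1 ((mul_comm _ _).trans hb), hsv, Finset.sum_add_distrib]
  simp_rw [← pow_two]
  field_simp
  ring
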